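/- Let X be a Banach space with a Schauder basis and let 1 ≤ p ≤ ∞. Assume that every infinite-dimensional block subspace W of X contains a sequence of infinite-dimensional block subspaces satisfying an upper ℓ_p-estimate with some finite constant. Then there exist an infinite-dimensional block subspace Y of X and a constant C < ∞ such that every infinite-dimensional block subspace Z of Y contains a sequence of infinite-dimensional block subspaces satisfying an upper ℓ_p-estimate with constant C. -/

import Mathlib

open scoped ENNReal
open Filter Topology

/-- The `ℓ_p` norm of a finite real sequence, `(∑ |a i|^p)^(1/p)` for `p < ∞`
and `max |a i|` for `p = ∞`. -/
noncomputable def lpNorm (p : ℝ≥0∞) {n : ℕ} (a : Fin n → ℝ) : ℝ :=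
  if p = ∞ then ⨆ i, |a i| else (∑ i, |a i| ^ p.toReal) ^ (1 / p.toReal)

/-- `e` is a Schauder basis of `X`: every vector has a unique representation as a
norm-convergent series `∑ a i • e i`. -/
def IsSchauderBasis {X : Type*} [NormedAddCommGroup X] [NormedSpace ℝ X] (e : ℕ → X) : Prop :=
  ∀ x : X, ∃! a : ℕ → ℝ,
    Tendsto (fun n => ∑ i ∈ Finset.range n, a i • e i) atTop (𝓝 x)

/-- `y` is an (infinite) block basic sequence of `e`: a sequence of nonzero vectors with
finite, successively ordered supports with respect to `e`. -/
def IsBlockSeq {X : Type*} [NormedAddCommGroup X] [NormedSpace ℝ X] (e : ℕ → X) (y : ℕ → X) : Prop :=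
  ∃ N : ℕ → ℕ, StrictMono N ∧ ∀ k, y k ≠ 0 ∧
    y k ∈ Submodule.span ℝ (e '' Set.Ico (N k) (N (k + 1)))

/-- A block subspace: the closed linear span of an infinite block basic sequence of `e`. -/
def IsBlockSubspace {X : Type*} [NormedAddCommGroup X] [NormedSpace ℝ X] (e : ℕ → X)
    (Y : Submodule ℝ X) : Prop :=
  ∃ y : ℕ → X, IsBlockSeq e y ∧ Y = (Submodule.span ℝ (Set.range y)).topologicalClosure

/-- The sequence of subspaces `E` satisfies an upper `ℓ_p`-estimate with constant `C`. -/
def UpperLpEstimate {X : Type*} [NormedAddCommGroup X] [NormedSpace ℝ X] (p : ℝ≥0∞)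
    (E : ℕ → Submodule ℝ X) (C : ℝ) : Prop :=
  ∀ (n : ℕ) (x : Fin n → X), (∀ j, x j ∈ E j.val) →
    ‖∑ j, x j‖ ≤ C * lpNorm p (fun j => ‖x j‖)

theorem IsSchauderBasis.linearIndependent {X : Type*} [NormedAddCommGroup X] [NormedSpace ℝ X]
    {e : ℕ → X} (he : IsSchauderBasis e) : LinearIndependent ℝ e := by
  rw [linearIndependent_iff']
  intro s g hg i hi
  have hconv : Tendsto (fun n => ∑ i ∈ Finset.range n, (if i ∈ s then g i else 0) • e i)
      atTop (𝓝 0) := by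
    obtain ⟨M, hM⟩ := s.exists_nat_subset_range
    refine tendsto_const_nhds.congr' ?_
    filter_upwards [eventually_ge_atTop M] with n hn
    have hsub : s ⊆ Finset.range n := hM.trans (Finset.range_mono hn)
    rw [← Finset.sum_subset hsub (fun x _ hx => by simp [hx]), ← hg]
    exact Finset.sum_congr rfl fun x hx => by simp [hx]
  have := congrFun ((he 0).unique hconv (y₂ := 0) (by simp)) i
  simpa [hi] using this

theorem IsSchauderBasis.isBlockSeq {X : Type*} [NormedAddCommGroup X] [NormedSpace ℝ X]
    {e : ℕ → X} (he : IsSchauderBasis e) : IsBlockSeq e e :=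
  ⟨id, strictMono_id, fun k => ⟨he.linearIndependent.ne_zero k,
    Submodule.subset_span ⟨k, by simp, rfl⟩⟩⟩

theorem IsBlockSeq.linearIndependent {X : Type*} [NormedAddCommGroup X] [NormedSpace ℝ X]
    {e y : ℕ → X} (he : LinearIndependent ℝ e) (hy : IsBlockSeq e y) :
    LinearIndependent ℝ y := by
  obtain ⟨N, hN, hy⟩ := hy
  rw [linearIndependent_iff']
  intro s
  induction s using Finset.induction_on_max with
  | empty => simp
  | insert a s ha ih =>
    intro g hg
    rw [Finset.sum_insert fun h => (ha a h).false] at hg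
    have hlow : ∑ i ∈ s, g i • y i ∈ Submodule.span ℝ (e '' Set.Iio (N a)) := by
      refine Submodule.sum_mem _ fun i hi => Submodule.smul_mem _ _ ?_
      refine Submodule.span_mono (Set.image_mono fun j hj => ?_) (hy i).2
      exact hj.2.trans_le (hN.monotone (ha i hi))
    have hzero : g a • y a = 0 := by
      refine Submodule.disjoint_def.1 (he.disjoint_span_image (s := Set.Iio (N a))
        (t := Set.Ico (N a) (N (a + 1))) ?_) _ ?_ (Submodule.smul_mem _ _ (hy a).2)
      · exact Set.disjoint_left.2 fun j hj hj' => (not_lt.2 hj'.1) hj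
      · rw [eq_neg_of_add_eq_zero_left hg]
        exact Submodule.neg_mem _ hlow
    have hga : g a = 0 := (smul_eq_zero.1 hzero).resolve_right (hy a).1
    rw [hzero, zero_add] at hg
    intro i hi
    rcases Finset.mem_insert.1 hi with rfl | hi
    exacts [hga, ih g hg i hi]

/-- Among more than `finrank F` linearly independent vectors of `F ⊔ K`, some nonzero
combination lies in `K`. -/
theorem exists_ne_zero_mem_of_mem_sup {X ι : Type*} [AddCommGroup X] [Module ℝ X] [Fintype ι]
    {F K : Submodule ℝ X} [FiniteDimensional ℝ F] {v : ι → X} (hv : LinearIndependent ℝ v)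
    (hcard : Module.finrank ℝ F < Fintype.card ι) (hmem : ∀ i, v i ∈ F ⊔ K) :
    ∃ z ∈ Submodule.span ℝ (Set.range v), z ≠ 0 ∧ z ∈ K := by
  choose f hf g hg hfg using fun i => Submodule.mem_sup.1 (hmem i)
  have hdep : ¬ LinearIndependent ℝ (fun i => (⟨f i, hf i⟩ : F)) := fun h =>
    hcard.not_ge h.fintype_card_le_finrank
  obtain ⟨c, hc, i, hi⟩ := Fintype.not_linearIndependent_iff.1 hdep
  have hc' : ∑ i, c i • f i = 0 := by simpa using congrArg F.subtype hc
  refine ⟨∑ i, c i • v i, Submodule.sum_mem _ fun i _ => Submodule.smul_mem _ _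
    (Submodule.subset_span ⟨i, rfl⟩), fun h => hi (Fintype.linearIndependent_iff.1 hv c h i), ?_⟩
  simp only [← hfg, smul_add, Finset.sum_add_distrib, hc', zero_add]
  exact Submodule.sum_mem _ fun i _ => Submodule.smul_mem _ _ (hg i)

/-- A block subspace contained in `F ⊔ K`, with `F` finite-dimensional and `K` closed, has a
further block subspace inside `K`. -/
theorem IsBlockSubspace.exists_le_of_le_sup {X : Type*} [NormedAddCommGroup X] [NormedSpace ℝ X]
    {e : ℕ → X} (he : LinearIndependent ℝ e) {E F K : Submodule ℝ X} [FiniteDimensional ℝ F]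
    (hE : IsBlockSubspace e E) (hK : IsClosed (K : Set X)) (hle : E ≤ F ⊔ K) :
    ∃ E', IsBlockSubspace e E' ∧ E' ≤ E ∧ E' ≤ K := by
  obtain ⟨y, hy, rfl⟩ := hE
  have hyind := hy.linearIndependent he
  obtain ⟨N, hN, hy⟩ := hy
  set d := Module.finrank ℝ F + 1 with hd
  have hz : ∀ k : ℕ, ∃ z ∈ Submodule.span ℝ (Set.range fun i : Fin d => y (k * d + i)),
      z ≠ 0 ∧ z ∈ K := fun k =>
    exists_ne_zero_mem_of_mem_sup (F := F)
      (hyind.comp (fun i : Fin d => k * d + i) fun i j hij => Fin.ext (by simpa using hij))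
      (by simp [hd])
      (fun i => hle (Submodule.le_topologicalClosure _ (Submodule.subset_span ⟨_, rfl⟩)))
  choose z hzspan hz0 hzK using hz
  refine ⟨_, ⟨z, ⟨fun k => N (k * d), fun a b hab => hN ?_, fun k => ⟨hz0 k, ?_⟩⟩, rfl⟩, ?_, ?_⟩
  · exact Nat.mul_lt_mul_of_pos_right hab (by omega)
  · refine Submodule.span_le.2 ?_ (hzspan k)
    rintro _ ⟨i, rfl⟩
    refine Submodule.span_mono (Set.image_mono (Set.Ico_subset_Ico ?_ ?_)) (hy (k * d + i)).2
    · exact hN.monotone (Nat.le_add_right _ _)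
    · refine hN.monotone ?_
      have := i.2
      rw [add_mul]
      omega
  · refine Submodule.topologicalClosure_mono (Submodule.span_le.2 ?_)
    rintro _ ⟨k, rfl⟩
    refine Submodule.span_mono ?_ (hzspan k)
    rintro _ ⟨i, rfl⟩
    exact ⟨_, rfl⟩
  · refine Submodule.topologicalClosure_minimal _ (Submodule.span_le.2 ?_) hK
    rintro _ ⟨k, rfl⟩
    exact hzK k

/-- A block subspace contains block vectors supported arbitrarily far out. -/
theorem IsBlockSubspace.exists_mem_span_Ico {X : Type*} [NormedAddCommGroup X] [NormedSpace ℝ X]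
    {e : ℕ → X} {Y : Submodule ℝ X} (hY : IsBlockSubspace e Y) (m : ℕ) :
    ∃ w ∈ Y, w ≠ 0 ∧ ∃ m' > m, w ∈ Submodule.span ℝ (e '' Set.Ico m m') := by
  obtain ⟨y, ⟨N, hN, hy⟩, rfl⟩ := hY
  refine ⟨y m, Submodule.le_topologicalClosure _ (Submodule.subset_span ⟨m, rfl⟩), (hy m).1,
    N (m + 1), hN.le_apply, ?_⟩
  exact Submodule.span_mono (Set.image_mono (Set.Ico_subset_Ico_left hN.le_apply)) (hy m).2

/-- Diagonal block sequence through a sequence of block subspaces. -/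
theorem exists_isBlockSeq_forall_mem {X : Type*} [NormedAddCommGroup X] [NormedSpace ℝ X]
    {e : ℕ → X} {Y : ℕ → Submodule ℝ X} (hY : ∀ n, IsBlockSubspace e (Y n)) :
    ∃ w, IsBlockSeq e w ∧ ∀ n, w n ∈ Y n := by
  choose w hwY hw0 next hnext hw using fun n => (hY n).exists_mem_span_Ico
  let M : ℕ → ℕ := Nat.rec 0 fun n m => next n m
  exact ⟨fun n => w n (M n), ⟨M, strictMono_nat_of_lt_succ fun n => hnext n (M n),
    fun n => ⟨hw0 n (M n), hw n (M n)⟩⟩, fun n => hwY n (M n)⟩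

theorem IsBlockSubspace.isClosed {X : Type*} [NormedAddCommGroup X] [NormedSpace ℝ X]
    {e : ℕ → X} {Y : Submodule ℝ X} (hY : IsBlockSubspace e Y) : IsClosed (Y : Set X) := by
  obtain ⟨y, -, rfl⟩ := hY
  exact Submodule.isClosed_topologicalClosure _

theorem lpNorm_nonneg (p : ℝ≥0∞) {n : ℕ} (a : Fin n → ℝ) : 0 ≤ lpNorm p a := by
  unfold lpNorm
  split_ifs
  · exact Real.iSup_nonneg fun i => abs_nonneg _
  · positivity

theorem UpperLpEstimate.mono {X : Type*} [NormedAddCommGroup X] [NormedSpace ℝ X] {p : ℝ≥0∞}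
    {E E' : ℕ → Submodule ℝ X} {C C' : ℝ} (h : UpperLpEstimate p E C) (hE : ∀ j, E' j ≤ E j)
    (hC : C ≤ C') : UpperLpEstimate p E' C' := fun n x hx =>
  (h n x fun j => hE _ (hx j)).trans (mul_le_mul_of_nonneg_right hC (lpNorm_nonneg _ _))

/-- If every infinite-dimensional block subspace `W` of `X` contains a sequence of
infinite-dimensional block subspaces with an upper `ℓ_p`-estimate (with some constant),
then there are a block subspace `Y` and a constant `C` such that every block subspace `Z`
of `Y` contains a sequence of infinite-dimensional block subspaces with an upper
`ℓ_p`-estimate with constant `C`. -/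
theorem exists_uniform_upper_estimate_block_subspace {X : Type*} [NormedAddCommGroup X]
    [NormedSpace ℝ X] [CompleteSpace X] (e : ℕ → X) (he : IsSchauderBasis e)
    (p : ℝ≥0∞) (hp : 1 ≤ p)
    (H : ∀ W : Submodule ℝ X, IsBlockSubspace e W →
      ∃ (E : ℕ → Submodule ℝ X) (C : ℝ),
        (∀ j, IsBlockSubspace e (E j) ∧ E j ≤ W) ∧ UpperLpEstimate p E C) :
    ∃ Y : Submodule ℝ X, IsBlockSubspace e Y ∧ ∃ C : ℝ,
      ∀ Z : Submodule ℝ X, IsBlockSubspace e Z → Z ≤ Y →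
        ∃ E : ℕ → Submodule ℝ X,
          (∀ j, IsBlockSubspace e (E j) ∧ E j ≤ Z) ∧ UpperLpEstimate p E C := by
  by_contra! hcon
  choose Z hZblock hZle hZ using fun (Y : {Y : Submodule ℝ X // IsBlockSubspace e Y}) (n : ℕ) =>
    hcon Y.1 Y.2 n
  let Y : ℕ → {Y : Submodule ℝ X // IsBlockSubspace e Y} :=
    Nat.rec ⟨_, e, he.isBlockSeq, rfl⟩ fun n Y => ⟨Z Y n, hZblock Y n⟩
  have hanti : Antitone fun n => (Y n).1 := antitone_nat_of_succ_le fun n => hZle (Y n) n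
  obtain ⟨w, hw, hwY⟩ := exists_isBlockSeq_forall_mem fun n => (Y n).2
  obtain ⟨E, C, hE, hEC⟩ := H _ ⟨w, hw, rfl⟩
  obtain ⟨n, hn⟩ := exists_nat_ge C
  let F := Submodule.span ℝ (w '' Set.Iio (n + 1))
  have : FiniteDimensional ℝ F :=
    FiniteDimensional.span_of_finite ℝ ((Set.finite_Iio (n + 1)).image w)
  have hW : (Submodule.span ℝ (Set.range w)).topologicalClosure ≤ F ⊔ (Y (n + 1)).1 := by
    refine Submodule.topologicalClosure_minimal _ (Submodule.span_le.2 ?_) ?_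
    · rintro _ ⟨k, rfl⟩
      rcases lt_or_ge k (n + 1) with hk | hk
      · exact Submodule.mem_sup_left (Submodule.subset_span ⟨k, hk, rfl⟩)
      · exact Submodule.mem_sup_right (hanti hk (hwY k))
    · rw [sup_comm]
      exact Submodule.isClosed_sup_finiteDimensional _ _ (Y (n + 1)).2.isClosed
  choose E' hE'block hE'E hE'Y using fun j => (hE j).1.exists_le_of_le_sup he.linearIndependent
    (Y (n + 1)).2.isClosed ((hE j).2.trans hW)
  exact hZ (Y n) n E' (fun j => ⟨hE'block j, hE'Y j⟩) (hEC.mono hE'E hn)
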